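/- For every integer d ≥ 9, let R_d = (ℤ/2ℤ)[x₁,…,x_d]/I_d, where I_d is the ideal generated by x₁², x_j² − x_j·x_{j−1} for j = 2,…,d−1, and x_d² − x_d·(x₁+⋯+x_{d−2}); set y₁ = 0, y_j = x_{j−1} for j = 2,…,d−1, and y_d = x₁+⋯+x_{d−2} in R_d, and let w₃ = Σ_{1 ≤ i < j < k ≤ d} y_i·y_j·y_k. Then Σ_{i=1}^{d} y_i = 0 and w₃² ≠ 0 in R_d. -/

import Mathlib

noncomputable section

/-- The generator `xⱼ` (paper-indexed, `j ∈ {1, …, d}`) of the polynomial ring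
`(ℤ/2ℤ)[x₁, …, x_d]`. -/
def Xv (d j : ℕ) : MvPolynomial (Fin d) (ZMod 2) :=
  if h : 1 ≤ j ∧ j ≤ d then MvPolynomial.X ⟨j - 1, by omega⟩ else 0

/-- The ideal `I_d` of `(ℤ/2ℤ)[x₁, …, x_d]` generated by `x₁²`, `xⱼ² − xⱼ·xⱼ₋₁` for
`j = 2, …, d−1`, and `x_d² − x_d·(x₁ + ⋯ + x_{d−2})`. -/
def bottIdeal (d : ℕ) : Ideal (MvPolynomial (Fin d) (ZMod 2)) :=
  Ideal.span
    ({Xv d 1 ^ 2, Xv d d ^ 2 - Xv d d * (∑ l ∈ Finset.Icc 1 (d - 2), Xv d l)} ∪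
      {p | ∃ j : ℕ, 2 ≤ j ∧ j ≤ d - 1 ∧ p = Xv d j ^ 2 - Xv d j * Xv d (j - 1)})

/-- The image of `xⱼ` in the quotient ring `R_d = (ℤ/2ℤ)[x₁, …, x_d]/I_d`, the mod-2
cohomology ring of the `d`-dimensional real Bott manifold `Y(A_d)`. -/
def xq (d j : ℕ) : MvPolynomial (Fin d) (ZMod 2) ⧸ bottIdeal d :=
  Ideal.Quotient.mk (bottIdeal d) (Xv d j)

/-- The classes `yⱼ` in `R_d`: `y₁ = 0`, `yⱼ = xⱼ₋₁` for `j = 2, …, d−1`, and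
`y_d = x₁ + ⋯ + x_{d−2}`. -/
def yq (d j : ℕ) : MvPolynomial (Fin d) (ZMod 2) ⧸ bottIdeal d :=
  if j = d then ∑ l ∈ Finset.Icc 1 (d - 2), xq d l
  else if 2 ≤ j ∧ j ≤ d - 1 then xq d (j - 1) else 0

theorem exists_quadratic_extension {S : Type} [CommRing S] (b : S) {c : S} (hc : c ≠ 0) :
    ∃ (T : Type) (_ : CommRing T) (f : S →+* T) (w : T), w ^ 2 = w * f b ∧ f c * w ≠ 0 := by
  refine ⟨QuadraticAlgebra S 0 b, inferInstance, algebraMap S _, QuadraticAlgebra.omega, ?_, ?_⟩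
  · ext <;> simp [pow_two]
  · intro h
    exact hc (by simpa using congrArg QuadraticAlgebra.im h)

/-- The mod-2 Bott ring of a four-step tower tensored with that of a two-step tower. -/
theorem exists_bottTower :
    ∃ (T : Type) (_ : CommRing T) (_ : ZMod 2 →+* T) (a b c d e f : T),
      a ^ 2 = 0 ∧ b ^ 2 = b * a ∧ c ^ 2 = c * b ∧ d ^ 2 = d * c ∧ e ^ 2 = 0 ∧ f ^ 2 = f * e ∧
        a * b * c * d * e * f ≠ 0 := by
  obtain ⟨T₁, _, g₁, a, ha, ha'⟩ := exists_quadratic_extension (0 : ZMod 2) one_ne_zero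
  obtain ⟨T₂, _, g₂, b, hb, hb'⟩ := exists_quadratic_extension a ha'
  obtain ⟨T₃, _, g₃, c, hc, hc'⟩ := exists_quadratic_extension b hb'
  obtain ⟨T₄, _, g₄, d, hd, hd'⟩ := exists_quadratic_extension c hc'
  obtain ⟨T₅, _, g₅, e, he, he'⟩ := exists_quadratic_extension 0 hd'
  obtain ⟨T₆, _, g₆, f, hf, hf'⟩ := exists_quadratic_extension e he'
  refine ⟨T₆, inferInstance, g₆.comp (g₅.comp (g₄.comp (g₃.comp (g₂.comp g₁)))),
    g₆ (g₅ (g₄ (g₃ (g₂ a)))), g₆ (g₅ (g₄ (g₃ b))), g₆ (g₅ (g₄ c)), g₆ (g₅ d), g₆ e, f, ?_⟩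
  simp only [← map_pow, ha, hb, hc, hd, he]
  simpa [mul_assoc] using ⟨hf, by simpa [mul_assoc] using hf'⟩

theorem sq_sum_cube {T : Type} [CommRing T] (h2 : (2 : T) = 0) {a b c d e f : T}
    (ha : a ^ 2 = 0) (hb : b ^ 2 = b * a) (hc : c ^ 2 = c * b) (hd : d ^ 2 = d * c)
    (he : e ^ 2 = 0) (hf : f ^ 2 = f * e) :
    (a ^ 3 + b ^ 3 + c ^ 3 + d ^ 3 + e ^ 3 + f ^ 3 + (a + b + c + d + e + f) ^ 3) ^ 2 =
      a * b * c * d * e * f := by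
  have hu : (b * a + c * b + d * c) ^ 2 = d * c * b * a := by grind
  have hu' : d * c * b * a * (b * a + c * b + d * c) = 0 := by grind
  have hv : (f * e) ^ 2 = 0 := by rw [mul_pow, he, mul_zero]
  have hs : (a + b + c + d + e + f) ^ 2 = b * a + c * b + d * c + f * e := by grind
  have h₂ : b ^ 3 = 0 := by grind
  have h₃ : c ^ 6 = 0 := by grind
  have h₄ : d ^ 6 = 0 := by grind
  have h₆ : f ^ 3 = 0 := by grind
  generalize a + b + c + d + e + f = s at hs ⊢
  generalize b * a + c * b + d * c = u at hu hu' hs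
  calc (a ^ 3 + b ^ 3 + c ^ 3 + d ^ 3 + e ^ 3 + f ^ 3 + s ^ 3) ^ 2
      = (a ^ 2) ^ 3 + (b ^ 3) ^ 2 + c ^ 6 + d ^ 6 + (e ^ 2) ^ 3 + (f ^ 3) ^ 2 + (s ^ 2) ^ 3 := by
        grind
    _ = u ^ 2 * (u + f * e) := by
        rw [ha, h₂, h₃, h₄, he, h₆, hs]
        linear_combination (3 * u + f * e) * hv + u ^ 2 * (f * e) * h2
    _ = a * b * c * d * e * f := by
        rw [hu]
        linear_combination hu'

/-- Newton's identity for the third power sum over an interval. -/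
theorem sum_cube_Icc {S : Type*} [CommRing S] (y : ℕ → S) (d m n : ℕ) (h : n + m = d + 1) :
    ∑ i ∈ Finset.Icc m d, y i ^ 3 = (∑ i ∈ Finset.Icc m d, y i) ^ 3
      - 3 * (∑ i ∈ Finset.Icc m d, y i) *
        (∑ i ∈ Finset.Icc m d, ∑ j ∈ Finset.Icc (i + 1) d, y i * y j)
      + 3 * ∑ i ∈ Finset.Icc m d, ∑ j ∈ Finset.Icc (i + 1) d, ∑ k ∈ Finset.Icc (j + 1) d,
          y i * y j * y k := by
  induction n generalizing m with
  | zero => simp [Finset.Icc_eq_empty (show ¬ m ≤ d by omega)]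
  | succ n ih =>
    have key := ih (m + 1) (by omega)
    simp only [← Finset.insert_Icc_add_one_left_eq_Icc (show m ≤ d by omega),
      Finset.sum_insert (show m ∉ Finset.Icc (m + 1) d by simp), mul_assoc, ← Finset.mul_sum]
      at key ⊢
    linear_combination key

/-- A specialization of the generators compatible with the relations of `bottIdeal d` induces a
ring homomorphism out of the quotient. -/
theorem exists_lift {T : Type} [CommRing T] (ι : ZMod 2 →+* T) (X : ℕ → T) {d : ℕ} (hd : 1 ≤ d)
    (h₁ : X 1 ^ 2 = 0) (hX : ∀ j, 2 ≤ j → j ≤ d - 1 → X j ^ 2 = X j * X (j - 1))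
    (hXd : X d = 0) :
    ∃ φ : MvPolynomial (Fin d) (ZMod 2) ⧸ bottIdeal d →+* T,
      ∀ j, 1 ≤ j → j ≤ d → φ (xq d j) = X j := by
  let g := MvPolynomial.eval₂Hom ι fun i : Fin d => X (i + 1)
  have hg : ∀ j, 1 ≤ j → j ≤ d → g (Xv d j) = X j := fun j h h' => by
    simp [g, Xv, h, h']
  have hker : ∀ p ∈ bottIdeal d, g p = 0 := by
    change bottIdeal d ≤ RingHom.ker g
    refine Ideal.span_le.2 ?_
    rintro p ((rfl | rfl) | ⟨j, h, h', rfl⟩)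
    · simp [RingHom.mem_ker, hg 1 le_rfl hd, h₁]
    · simp [RingHom.mem_ker, hg d hd le_rfl, hXd]
    · simp [RingHom.mem_ker, hg j (by omega) (by omega), hg (j - 1) (by omega) (by omega),
        hX j h h']
  exact ⟨Ideal.Quotient.lift _ g hker, fun j h h' => hg j h h'⟩

theorem two_eq_zero_of_ringHom {S : Type*} [CommRing S] (ι : ZMod 2 →+* S) : (2 : S) = 0 := by
  have h : (2 : ZMod 2) = 0 := rfl
  rw [← map_ofNat ι 2, h, map_zero]

theorem sum_yq {M : Type*} [AddCommMonoid M] {d : ℕ} (hd : 2 ≤ d)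
    (F : MvPolynomial (Fin d) (ZMod 2) ⧸ bottIdeal d → M) (hF : F 0 = 0) :
    ∑ i ∈ Finset.Icc 1 d, F (yq d i) =
      ∑ l ∈ Finset.Icc 1 (d - 2), F (xq d l) + F (∑ l ∈ Finset.Icc 1 (d - 2), xq d l) := by
  obtain ⟨n, rfl⟩ := Nat.exists_eq_add_of_le' hd
  rw [Finset.sum_Icc_succ_top (by omega), ← Finset.insert_Icc_add_one_left_eq_Icc (by omega),
    Finset.sum_insert (by simp), Nat.add_sub_cancel]
  have h₁ : yq (n + 2) 1 = 0 := by simp [yq]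
  have h₂ : yq (n + 2) (n + 1 + 1) = ∑ l ∈ Finset.Icc 1 n, xq (n + 2) l := by simp [yq]
  rw [h₁, h₂, hF, zero_add, ← Finset.map_add_right_Icc, Finset.sum_map]
  congr 1
  refine Finset.sum_congr rfl fun l hl => ?_
  rw [Finset.mem_Icc] at hl
  simp [yq, show l ≠ n + 1 by omega, hl.1, hl.2]

/-- For every integer `d ≥ 9`, in the ring `R_d = (ℤ/2ℤ)[x₁,…,x_d]/I_d`,
with `w₃ = Σ_{1 ≤ i < j < k ≤ d} yᵢ·yⱼ·y_k` the third Stiefel–Whitney class of the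
`d`-dimensional real Bott manifold `Y(A_d)`, one has `Σ_{i=1}^{d} yᵢ = 0` (orientability)
and `w₃² ≠ 0`. -/
theorem stmt17 :
    ∀ d : ℕ, 9 ≤ d →
      (∑ i ∈ Finset.Icc 1 d, yq d i) = 0 ∧
        (∑ i ∈ Finset.Icc 1 d, ∑ j ∈ Finset.Icc (i + 1) d, ∑ k ∈ Finset.Icc (j + 1) d,
            yq d i * yq d j * yq d k) ^ 2 ≠ 0 := by
  intro d hd
  have h2 := two_eq_zero_of_ringHom
    (algebraMap (ZMod 2) (MvPolynomial (Fin d) (ZMod 2) ⧸ bottIdeal d))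
  have hsum : ∑ i ∈ Finset.Icc 1 d, yq d i = 0 := by
    rw [sum_yq (by omega) (fun z => z) rfl, ← two_mul, h2, zero_mul]
  refine ⟨hsum, fun hw => ?_⟩
  have hcube := sum_cube_Icc (yq d) d 1 d rfl
  rw [hsum, sum_yq (by omega) (fun z => z ^ 3) (by simp)] at hcube
  generalize ∑ i ∈ Finset.Icc 1 d, ∑ j ∈ Finset.Icc (i + 1) d, ∑ k ∈ Finset.Icc (j + 1) d,
    yq d i * yq d j * yq d k = w at hw hcube
  have hw' : w = ∑ l ∈ Finset.Icc 1 (d - 2), xq d l ^ 3 +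
      (∑ l ∈ Finset.Icc 1 (d - 2), xq d l) ^ 3 := by linear_combination -hcube - w * h2
  rw [hw'] at hw
  obtain ⟨T, _, ι, a, b, c, u, e, f, ha, hb, hc, hu, he, hf, hne⟩ := exists_bottTower
  let X : ℕ → T
    | 1 => a | 2 => b | 3 => c | 4 => u | 6 => e | 7 => f | _ => 0
  have hX : ∀ j, 8 ≤ j → X j = 0 := fun j hj => by
    obtain ⟨k, rfl⟩ := Nat.exists_eq_add_of_le' hj
    rfl
  obtain ⟨φ, hφ⟩ := exists_lift ι X (d := d) (by omega) ha
    (fun j hj _ => by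
      rcases lt_or_ge j 8 with h | h
      · interval_cases j <;> simp [X, *]
      · simp [hX j h]) (hX d (by omega))
  have hsumX : ∀ k, k ≠ 0 → ∑ l ∈ Finset.Icc 1 (d - 2), φ (xq d l) ^ k =
      a ^ k + b ^ k + c ^ k + u ^ k + e ^ k + f ^ k := fun k hk => by
    have hsub : Finset.Icc 1 7 ⊆ Finset.Icc 1 (d - 2) := Finset.Icc_subset_Icc_right (by omega)
    have hφX : ∀ l ∈ Finset.Icc 1 (d - 2), φ (xq d l) ^ k = X l ^ k := fun l hl => by
      rw [Finset.mem_Icc] at hl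
      rw [hφ l (by omega) (by omega)]
    rw [Finset.sum_congr rfl hφX, ← Finset.sum_subset hsub]
    · simp [Finset.sum_Icc_succ_top, X, hk]
    · intro l hl hl'
      rw [Finset.mem_Icc] at hl hl'
      rw [hX l (by omega), zero_pow hk]
  apply hne
  rw [← sq_sum_cube (two_eq_zero_of_ringHom ι) ha hb hc hu he hf, ← hsumX 3 (by simp)]
  have h1 := hsumX 1 one_ne_zero
  simp only [pow_one] at h1
  rw [← h1]
  simpa using congrArg φ hw

end
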